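/- The 3×3 rooks graph K_3 □ K_3 is the unique graph (up to isomorphism) on 9 vertices with lazy cop number 3: every connected simple graph H on 9 vertices not isomorphic to K_3 □ K_3 satisfies c_L(H) ≤ 2, while c_L(K_3 □ K_3) = 3. -/

import Mathlib

/-!
Cops and robbers on a simple graph `G`.

A *configuration* consists of the positions of the `k` cops (a function
`Fin k → V`) together with the robber's position, with the cops to move.
The cops win if at some point a cop occupies the robber's vertex.
-/

namespace CopsRobbers

variable {V : Type*}

/-- From cop positions `c` and robber position `r`, with the cops to move,
the cops (each of whom may move along an edge or stay put on the cops' turn)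
can guarantee to catch the robber.  Either a cop is already on the robber,
or the cops can move so that a cop lands on the robber, or the cops can move
so that whatever (legal) move the robber then makes, the resulting
configuration is again winning for the cops. -/
inductive CopsWinFrom (G : SimpleGraph V) {k : ℕ} : (Fin k → V) → V → Prop
  | caught {c : Fin k → V} {r : V} (i : Fin k) (h : c i = r) : CopsWinFrom G c r
  | stepCatch {c : Fin k → V} {r : V} (c' : Fin k → V)
      (hmove : ∀ i, c' i = c i ∨ G.Adj (c i) (c' i))
      (i : Fin k) (h : c' i = r) : CopsWinFrom G c r
  | step {c : Fin k → V} {r : V} (c' : Fin k → V)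
      (hmove : ∀ i, c' i = c i ∨ G.Adj (c i) (c' i))
      (hnext : ∀ r', (r' = r ∨ G.Adj r r') → CopsWinFrom G c' r') :
      CopsWinFrom G c r

/-- `k` cops have a winning strategy on `G` in the ordinary game: they choose
starting positions, and then whatever vertex the robber starts on, they can
catch him. -/
def CopsWin (G : SimpleGraph V) (k : ℕ) : Prop :=
  ∃ c₀ : Fin k → V, ∀ r₀ : V, CopsWinFrom G c₀ r₀

/-- The cop number `c(G)`: the least number of cops that have a winning
strategy on `G`. -/
noncomputable def copNumber (G : SimpleGraph V) : ℕ :=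
  sInf {k | CopsWin G k}

/-- The lazy variant: from cop positions `c` and robber position `r`, with the
cops to move, the cops can catch the robber, where on each cops' turn at most
one cop (cop `j`) moves along an edge (all others stay put). -/
inductive LazyWinFrom (G : SimpleGraph V) {k : ℕ} : (Fin k → V) → V → Prop
  | caught {c : Fin k → V} {r : V} (i : Fin k) (h : c i = r) : LazyWinFrom G c r
  | stepCatch {c : Fin k → V} {r : V} (c' : Fin k → V) (j : Fin k)
      (hmove : c' j = c j ∨ G.Adj (c j) (c' j))
      (hfix : ∀ i, i ≠ j → c' i = c i)
      (i : Fin k) (h : c' i = r) : LazyWinFrom G c r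
  | step {c : Fin k → V} {r : V} (c' : Fin k → V) (j : Fin k)
      (hmove : c' j = c j ∨ G.Adj (c j) (c' j))
      (hfix : ∀ i, i ≠ j → c' i = c i)
      (hnext : ∀ r', (r' = r ∨ G.Adj r r') → LazyWinFrom G c' r') :
      LazyWinFrom G c r

/-- `k` lazy cops have a winning strategy on `G`. -/
def LazyCopsWin (G : SimpleGraph V) (k : ℕ) : Prop :=
  ∃ c₀ : Fin k → V, ∀ r₀ : V, LazyWinFrom G c₀ r₀

/-- The lazy cop number `c_L(G)`. -/
noncomputable def lazyCopNumber (G : SimpleGraph V) : ℕ :=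
  sInf {k | LazyCopsWin G k}

/-- A dominating set: every vertex is in `S` or adjacent to a member of `S`. -/
def IsDominatingSet (G : SimpleGraph V) (S : Set V) : Prop :=
  ∀ v : V, v ∈ S ∨ ∃ u ∈ S, G.Adj u v

/-- The domination number `γ(G)`: the least size of a dominating set. -/
noncomputable def dominationNumber (G : SimpleGraph V) [Fintype V] : ℕ :=
  sInf {m | ∃ S : Finset V, S.card = m ∧ IsDominatingSet G ↑S}

/-- The `n × n` rooks graph `K_n □ K_n`. -/
def rooksGraph (n : ℕ) : SimpleGraph (Fin n × Fin n) :=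
  SimpleGraph.boxProd ⊤ ⊤


section Lazy

variable {G : SimpleGraph V}

/-- `x` covers `y` if `y` lies in the closed neighbourhood of `x`. -/
def Covers (G : SimpleGraph V) (x y : V) : Prop := x = y ∨ G.Adj x y

lemma Covers.refl (x : V) : Covers G x x := Or.inl rfl

lemma Covers.symm {x y : V} (h : Covers G x y) : Covers G y x :=
  h.imp Eq.symm fun h => h.symm

/-- Two lazy cops at `a` and `b`, to move, catch a robber at `r`. -/
abbrev Win (G : SimpleGraph V) (a b r : V) : Prop := LazyWinFrom G ![a, b] r

lemma LazyWinFrom.comp_perm {k : ℕ} {c : Fin k → V} {r : V} (h : LazyWinFrom G c r)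
    (σ : Equiv.Perm (Fin k)) : LazyWinFrom G (c ∘ σ) r := by
  induction h with
  | caught i h => exact .caught (σ.symm i) (by simpa using h)
  | stepCatch c' j hmove hfix i h =>
    exact .stepCatch (c' ∘ σ) (σ.symm j) (by simpa using hmove)
      (fun i hi => hfix _ fun h => hi (by simp [← h])) (σ.symm i) (by simpa using h)
  | step c' j hmove hfix _ ih =>
    exact .step (c' ∘ σ) (σ.symm j) (by simpa using hmove)
      (fun i hi => hfix _ fun h => hi (by simp [← h])) ih

lemma Win.swap {a b r : V} (h : Win G a b r) : Win G b a r := by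
  have e : ![b, a] = ![a, b] ∘ Equiv.swap (0 : Fin 2) 1 := by
    funext i; fin_cases i <;> simp
  unfold Win
  rw [e]
  exact h.comp_perm _

lemma Win.of_covers_left {a b r : V} (h : Covers G a r) : Win G a b r := by
  rcases h with rfl | h
  · exact .caught 0 rfl
  · refine .stepCatch ![r, b] 0 (Or.inr h) (fun i hi => ?_) 0 rfl
    fin_cases i
    · exact absurd rfl hi
    · rfl

lemma Win.of_covers_right {a b r : V} (h : Covers G b r) : Win G a b r :=
  (Win.of_covers_left h).swap

lemma Win.step_left {a b r : V} (a' : V) (ha : Covers G a a')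
    (h : ∀ r', Covers G r r' → Win G a' b r') : Win G a b r := by
  refine .step ![a', b] 0 (ha.imp Eq.symm id) (fun i hi => ?_)
    fun r' hr' => h r' (hr'.imp Eq.symm id)
  fin_cases i
  · exact absurd rfl hi
  · rfl

lemma Win.step_right {a b r : V} (b' : V) (hb : Covers G b b')
    (h : ∀ r', Covers G r r' → Win G a b' r') : Win G a b r :=
  (Win.step_left b' hb fun r' hr' => (h r' hr').swap).swap

/-- If a cop can move so that every continuation of the robber is covered, the cops win. -/
lemma Win.of_surround_left {a b r : V} (a' : V) (ha : Covers G a a')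
    (h : ∀ y, Covers G r y → Covers G a' y ∨ Covers G b y) : Win G a b r :=
  Win.step_left a' ha fun y hy => (h y hy).elim .of_covers_left .of_covers_right

lemma Win.of_surround_right {a b r : V} (b' : V) (hb : Covers G b b')
    (h : ∀ y, Covers G r y → Covers G a y ∨ Covers G b' y) : Win G a b r :=
  Win.step_right b' hb fun y hy => (h y hy).elim .of_covers_left .of_covers_right

/-- While the cop at `v` confines the robber to `T`, the other cop may walk anywhere. -/
lemma Win.of_reachable {v u b : V} {T : Set V}
    (hT : ∀ x ∈ T, ∀ y, G.Adj x y → y ∈ T ∨ Covers G v y)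
    (h : ∀ r ∈ T, Win G v u r) (hb : G.Reachable b u) : ∀ r ∈ T, Win G v b r := by
  obtain ⟨w⟩ := hb
  induction w with
  | nil => exact h
  | cons hadj _ ih =>
    intro r hr
    refine Win.step_right _ (Or.inr hadj) fun r' hr' => ?_
    rcases hr' with rfl | hr'
    · exact ih h r hr
    · rcases hT r hr r' hr' with hmem | hcov
      · exact ih h r' hmem
      · exact .of_covers_left hcov

/-- A robber all of whose neighbours are covered by one cop is caught by the other one. -/
lemma Win.of_trapped (hG : G.Connected) {u r : V} (a : V)
    (h : ∀ y, G.Adj r y → Covers G u y) : Win G a u r := by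
  refine Win.swap (Win.of_reachable (T := {r}) (u := r) ?_ ?_ (hG.preconnected a r) r rfl)
  · rintro x rfl y hy
    exact Or.inr (h y hy)
  · rintro x rfl
    exact .of_covers_right (.refl _)

/-- A connected region in which the robber evades one cop while the other one guards `v`. -/
structure IsLair (G : SimpleGraph V) (v : V) (T : Finset V) : Prop where
  avoid : ∀ x ∈ T, ¬ Covers G v x
  closed : ∀ x ∈ T, ∀ y, G.Adj x y → ¬ Covers G v y → y ∈ T
  conn : ∀ T' ⊆ T, T'.Nonempty → (∀ x ∈ T', ∀ y ∈ T, G.Adj x y → y ∈ T') → T' = T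
  escape : ∀ u, ∃ r ∈ T, ¬ Win G v u r

lemma exists_isLair [Fintype V] (hG : G.Connected) (hw : ¬ LazyCopsWin G 2) (v : V) :
    ∃ T, IsLair G v T := by
  classical
  have hr₀ : ∃ r, ¬ Win G v v r := by
    by_contra! h
    exact hw ⟨_, h⟩
  obtain ⟨r, hr⟩ := hr₀
  let R : V → V → Prop := fun x y => G.Adj x y ∧ ¬ Covers G v x ∧ ¬ Covers G v y
  have : Std.Symm R := ⟨fun x y h => ⟨h.1.symm, h.2.2, h.2.1⟩⟩
  let T : Finset V := Finset.univ.filter (Relation.ReflTransGen R r)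
  have hmem : ∀ x, x ∈ T ↔ Relation.ReflTransGen R r x := by simp [T]
  have havoid : ∀ x ∈ T, ¬ Covers G v x := by
    intro x hx
    rcases ((hmem x).1 hx).cases_tail with rfl | ⟨_, _, h⟩
    · exact fun h => hr (.of_covers_left h)
    · exact h.2.2
  have hclosed : ∀ x ∈ T, ∀ y, G.Adj x y → ¬ Covers G v y → y ∈ T := fun x hx y hxy hy =>
    (hmem y).2 (((hmem x).1 hx).tail ⟨hxy, havoid x hx, hy⟩)
  refine ⟨T, havoid, hclosed, ?_, ?_⟩
  · rintro T' hT' ⟨t, ht⟩ hcl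
    refine Finset.Subset.antisymm hT' fun x hx => ?_
    have htx : Relation.ReflTransGen R t x :=
      (symm ((hmem t).1 (hT' ht))).trans ((hmem x).1 hx)
    clear hx
    induction htx with
    | refl => exact ht
    | tail _ h ih => exact hcl _ ih _ (hclosed _ (hT' ih) _ h.1 h.2.2) h.1
  · intro u
    by_contra! h
    refine hr (Win.of_reachable (T := {x | x ∈ T}) ?_ h (hG.preconnected v u) r
      ((hmem r).2 .refl))
    intro x hx y hxy
    by_cases hy : Covers G v y
    · exact Or.inr hy
    · exact Or.inl (hclosed x hx y hxy hy)

namespace IsLair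

variable {v : V} {T : Finset V}

lemma exists_not_covers (h : IsLair G v T) (u : V) :
    ∃ r ∈ T, ¬ Covers G u r ∧ ¬ Win G v u r := by
  obtain ⟨r, hr, hw⟩ := h.escape u
  exact ⟨r, hr, fun hc => hw (.of_covers_right hc), hw⟩

lemma nonempty (h : IsLair G v T) : T.Nonempty :=
  let ⟨r, hr, _⟩ := h.escape v
  ⟨r, hr⟩

lemma exists_adj (h : IsLair G v T) {x : V} (hx : x ∈ T) : ∃ y ∈ T, G.Adj x y := by
  by_contra! hn
  have e := h.conn {x} (by simpa using hx) ⟨x, by simp⟩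
    (by simpa using fun y hy hxy => absurd hxy (hn y hy))
  obtain ⟨r, hr, hc, _⟩ := h.exists_not_covers x
  rw [← e, Finset.mem_singleton] at hr
  exact hc (Or.inl hr.symm)

lemma exists_path (h : IsLair G v T) :
    ∃ q ∈ T, ∃ x ∈ T, ∃ y ∈ T, G.Adj q x ∧ G.Adj q y ∧ x ≠ y ∧ ¬ G.Adj x y := by
  classical
  obtain ⟨u, hu⟩ := h.nonempty
  by_contra! hn
  have e := h.conn (T.filter (Covers G u)) (Finset.filter_subset _ _)
    ⟨u, by simp [hu, Covers.refl]⟩ (by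
      intro x hx y hy hxy
      simp only [Finset.mem_filter] at hx ⊢
      refine ⟨hy, ?_⟩
      rcases hx.2 with rfl | hux
      · exact Or.inr hxy
      · by_cases huy : u = y
        · exact Or.inl huy
        · exact Or.inr (hn x hx.1 u hu y hy hux.symm hxy huy))
  obtain ⟨r, hr, hc, _⟩ := h.exists_not_covers u
  rw [← e] at hr
  exact hc (Finset.mem_filter.1 hr).2

/-- The robber at `s` cannot be confined to `s` and a neighbour `w` within reach of the cop. -/
lemma win_of_unique_adj (h : IsLair G v T) {u w s : V} (hs : s ∈ T) (huw : Covers G u w)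
    (hws : G.Adj w s) (huniq : ∀ y ∈ T, G.Adj s y → y = w) : Win G v u s := by
  refine Win.of_surround_right w huw fun y hy => ?_
  rcases hy with rfl | hy
  · exact Or.inr (Or.inr hws)
  · by_cases hv : Covers G v y
    · exact Or.inl hv
    · exact Or.inr (Or.inl (huniq y (h.closed s hs y hy hv) hy).symm)

lemma chase (h : IsLair G v T)
    (hdeg : ∀ q ∈ T, ∀ x ∈ T, ∀ y ∈ T, ∀ z ∈ T, G.Adj q x → G.Adj q y → G.Adj q z →
      x = y ∨ x = z ∨ y = z) :
    ∀ (n : ℕ) (T' : Finset V) (b y : V), T'.card = n → T' ⊆ T → b ∈ T → b ∉ T' → y ∈ T →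
      y ∉ T' → G.Adj b y → (∀ x ∈ T', ∀ z ∈ T, G.Adj x z → z ∈ T' ∨ z = y) →
      ∀ r ∈ T', Win G v b r := by
  classical
  intro n
  induction n with
  | zero =>
    intro T' b y hn _ _ _ _ _ _ _ r hr
    simp [Finset.card_eq_zero.1 hn] at hr
  | succ n ih =>
    intro T' b y hn hsub hb hb' hy hy' hby hcl r hr
    have ht : ∃ t ∈ T', G.Adj y t := by
      by_contra! hno
      have e := h.conn T' hsub ⟨r, hr⟩ fun x hx z hz hxz =>
        (hcl x hx z hz hxz).resolve_right fun hzy => hno x hx (hzy ▸ hxz.symm)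
      exact hy' (e ▸ hy)
    obtain ⟨t, ht, hyt⟩ := ht
    have huniq : ∀ x ∈ T', G.Adj y x → x = t := by
      intro x hx hyx
      rcases hdeg y hy b hb x (hsub hx) t (hsub ht) hby.symm hyx hyt with e | e | e
      · exact absurd hx (e ▸ hb')
      · exact absurd ht (e ▸ hb')
      · exact e
    have hrec := ih (T'.erase t) y t (by rw [Finset.card_erase_of_mem ht, hn]; rfl)
      ((Finset.erase_subset _ _).trans hsub) hy (fun hm => hy' (Finset.mem_of_mem_erase hm))
      (hsub ht) (Finset.notMem_erase _ _) hyt (by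
        intro x hx z hz hxz
        have hx' := Finset.mem_erase.1 hx
        rcases hcl x hx'.2 z hz hxz with hz' | rfl
        · by_cases hzt : z = t
          · exact Or.inr hzt
          · exact Or.inl (Finset.mem_erase.2 ⟨hzt, hz'⟩)
        · exact absurd (huniq x hx'.2 hxz.symm) hx'.1)
    have hrec' : ∀ s ∈ T', Win G v y s := by
      intro s hs
      by_cases hst : s = t
      · exact .of_covers_right (Or.inr (hst ▸ hyt))
      · exact hrec s (Finset.mem_erase.2 ⟨hst, hs⟩)
    refine Win.step_right y (Or.inr hby) fun r' hr' => ?_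
    rcases hr' with rfl | hr'
    · exact hrec' r hr
    · by_cases hv : Covers G v r'
      · exact .of_covers_left hv
      · rcases hcl r hr r' (h.closed r (hsub hr) r' hr' hv) hr' with h' | rfl
        · exact hrec' r' h'
        · exact .of_covers_right (.refl _)

/-- A lair with maximum degree two has no endpoint: a cop would sweep it from there. -/
lemma exists_ne_adj (h : IsLair G v T)
    (hdeg : ∀ q ∈ T, ∀ x ∈ T, ∀ y ∈ T, ∀ z ∈ T, G.Adj q x → G.Adj q y → G.Adj q z →
      x = y ∨ x = z ∨ y = z) {p q : V} (hp : p ∈ T) (hq : q ∈ T) (hpq : G.Adj p q) :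
    ∃ x ∈ T, G.Adj p x ∧ x ≠ q := by
  classical
  by_contra! hn
  obtain ⟨r, hr, hc, hw⟩ := h.exists_not_covers p
  have hrq : r ≠ q := fun e => hc (Or.inr (e ▸ hpq))
  have hrp : r ≠ p := fun e => hc (Or.inl e.symm)
  refine hw (h.chase hdeg _ ((T.erase p).erase q) p q rfl
    ((Finset.erase_subset _ _).trans (Finset.erase_subset _ _)) hp (by simp) hq (by simp) hpq
    ?_ r (by simp [hr, hrq, hrp]))
  intro x hx z hz hxz
  simp only [Finset.mem_erase] at hx ⊢
  by_cases hzq : z = q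
  · exact Or.inr hzq
  · refine Or.inl ⟨hzq, ?_, hz⟩
    rintro rfl
    exact hx.1 (hn x hx.2.2 hxz.symm)

end IsLair

section Degree

lemma eq_or_of_adj_three [Fintype V] [DecidableRel G.Adj] {v x y z w : V} (hd : G.degree v ≤ 3)
    (hx : G.Adj v x) (hy : G.Adj v y) (hz : G.Adj v z) (hxy : x ≠ y) (hxz : x ≠ z) (hyz : y ≠ z)
    (hw : G.Adj v w) : w = x ∨ w = y ∨ w = z := by
  classical
  have hc : ({x, y, z} : Finset V).card = 3 := by simp [*]
  have e := Finset.eq_of_subset_of_card_le (s := {x, y, z}) (t := G.neighborFinset v)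
    (by intro u; simp; rintro (rfl | rfl | rfl) <;> assumption)
    (by rw [hc, SimpleGraph.card_neighborFinset_eq_degree]; exact hd)
  have : w ∈ G.neighborFinset v := by simpa using hw
  simpa [← e] using this

lemma eq_or_of_adj_four [Fintype V] [DecidableRel G.Adj] {v x y z t w : V} (hd : G.degree v ≤ 4)
    (hx : G.Adj v x) (hy : G.Adj v y) (hz : G.Adj v z) (ht : G.Adj v t) (hxy : x ≠ y)
    (hxz : x ≠ z) (hxt : x ≠ t) (hyz : y ≠ z) (hyt : y ≠ t) (hzt : z ≠ t)
    (hw : G.Adj v w) : w = x ∨ w = y ∨ w = z ∨ w = t := by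
  classical
  have hc : ({x, y, z, t} : Finset V).card = 4 := by simp [*]
  have e := Finset.eq_of_subset_of_card_le (s := {x, y, z, t}) (t := G.neighborFinset v)
    (by intro u; simp; rintro (rfl | rfl | rfl | rfl) <;> assumption)
    (by rw [hc, SimpleGraph.card_neighborFinset_eq_degree]; exact hd)
  have : w ∈ G.neighborFinset v := by simpa using hw
  simpa [← e] using this

lemma four_le_degree [Fintype V] [DecidableRel G.Adj] {v x y z t : V}
    (hx : G.Adj v x) (hy : G.Adj v y) (hz : G.Adj v z) (ht : G.Adj v t) (hxy : x ≠ y)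
    (hxz : x ≠ z) (hxt : x ≠ t) (hyz : y ≠ z) (hyt : y ≠ t) (hzt : z ≠ t) :
    4 ≤ G.degree v := by
  classical
  have hc : ({x, y, z, t} : Finset V).card = 4 := by simp [*]
  rw [← hc, ← SimpleGraph.card_neighborFinset_eq_degree]
  exact Finset.card_le_card (by intro u; simp; rintro (rfl | rfl | rfl | rfl) <;> assumption)

lemma three_le_degree [Fintype V] [DecidableRel G.Adj] {v x y z : V}
    (hx : G.Adj v x) (hy : G.Adj v y) (hz : G.Adj v z) (hxy : x ≠ y) (hxz : x ≠ z)
    (hyz : y ≠ z) : 3 ≤ G.degree v := by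
  classical
  have hc : ({x, y, z} : Finset V).card = 3 := by simp [*]
  rw [← hc, ← SimpleGraph.card_neighborFinset_eq_degree]
  exact Finset.card_le_card (by intro u; simp; rintro (rfl | rfl | rfl) <;> assumption)

/-- The vertices not covered by `v`. -/
noncomputable def uncovered [Fintype V] (G : SimpleGraph V) (v : V) : Finset V := by
  classical exact Finset.univ.filter fun x => ¬ Covers G v x

lemma mem_uncovered [Fintype V] {v x : V} : x ∈ uncovered G v ↔ ¬ Covers G v x := by
  classical simp [uncovered]

lemma card_uncovered_add_degree [Fintype V] [DecidableRel G.Adj] (v : V) :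
    (uncovered G v).card + G.degree v + 1 = Fintype.card V := by
  classical
  have e : uncovered G v = (insert v (G.neighborFinset v))ᶜ := by
    ext x
    simp [mem_uncovered, Covers, eq_comm]
  have h := Finset.card_compl_add_card (insert v (G.neighborFinset v))
  rw [Finset.card_insert_of_notMem (by simp), SimpleGraph.card_neighborFinset_eq_degree,
    ← e] at h
  omega

lemma exists_boundary (hG : G.Connected) {T : Finset V} {v : V} (hT : T.Nonempty) (hv : v ∉ T) :
    ∃ p ∈ T, ∃ e ∉ T, G.Adj p e := by
  obtain ⟨t, ht⟩ := hT
  obtain ⟨w⟩ := hG.preconnected t v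
  obtain ⟨d, _, h1, h2⟩ := w.exists_boundary_dart (T : Set V) ht hv
  exact ⟨_, h1, _, h2, d.adj⟩

end Degree

namespace IsLair

variable {v : V} {T : Finset V}

lemma subset_uncovered [Fintype V] (h : IsLair G v T) : T ⊆ uncovered G v := fun x hx =>
  mem_uncovered.2 (h.avoid x hx)

lemma four_le_card (h : IsLair G v T) : 4 ≤ T.card := by
  classical
  obtain ⟨q, hq, x, hx, y, hy, hqx, hqy, hxy, _⟩ := h.exists_path
  obtain ⟨s, hs, hqs, _⟩ := h.exists_not_covers q
  have hqs' : q ≠ s := fun e => hqs (Or.inl e)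
  have hxs : x ≠ s := fun e => hqs (Or.inr (e ▸ hqx))
  have hys : y ≠ s := fun e => hqs (Or.inr (e ▸ hqy))
  have hc : ({q, x, y, s} : Finset V).card = 4 := by simp [*, hqx.ne, hqy.ne]
  rw [← hc]
  exact Finset.card_le_card (by intro u; simp; rintro (rfl | rfl | rfl | rfl) <;> assumption)

lemma degree_le_four [Fintype V] [DecidableRel G.Adj] (h : IsLair G v T) (hV : Fintype.card V = 9) :
    G.degree v ≤ 4 := by
  have h1 := h.four_le_card.trans (Finset.card_le_card h.subset_uncovered)
  have h2 := card_uncovered_add_degree (G := G) v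
  omega

lemma mem_of_card_le [Fintype V] [DecidableRel G.Adj] (h : IsLair G v T) (hV : Fintype.card V = 9)
    (hT : 8 ≤ G.degree v + T.card) {x : V} (hx : ¬ Covers G v x) : x ∈ T := by
  have h2 := card_uncovered_add_degree (G := G) v
  rw [Finset.eq_of_subset_of_card_le h.subset_uncovered (by omega)]
  exact mem_uncovered.2 hx

end IsLair

/-- The vertices not covered by `v` form an induced four-cycle whose opposite corners are safe
for a robber. -/
structure Quad (G : SimpleGraph V) (v p₀ p₁ p₂ p₃ : V) : Prop where
  avoid₀ : ¬ Covers G v p₀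
  avoid₁ : ¬ Covers G v p₁
  avoid₂ : ¬ Covers G v p₂
  avoid₃ : ¬ Covers G v p₃
  adj₀₁ : G.Adj p₀ p₁
  adj₁₂ : G.Adj p₁ p₂
  adj₂₃ : G.Adj p₂ p₃
  adj₃₀ : G.Adj p₃ p₀
  not_covers₀₂ : ¬ Covers G p₀ p₂
  not_covers₁₃ : ¬ Covers G p₁ p₃
  eq_or : ∀ x, ¬ Covers G v x → x = p₀ ∨ x = p₁ ∨ x = p₂ ∨ x = p₃
  escape₀ : ¬ Win G v p₂ p₀
  escape₁ : ¬ Win G v p₃ p₁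
  escape₂ : ¬ Win G v p₀ p₂
  escape₃ : ¬ Win G v p₁ p₃

lemma IsLair.exists_quad [Fintype V] [DecidableRel G.Adj] {v : V} {T : Finset V}
    (h : IsLair G v T) (hV : Fintype.card V = 9) (hv : G.degree v = 4) :
    ∃ p₀ p₁ p₂ p₃, Quad G v p₀ p₁ p₂ p₃ := by
  classical
  obtain ⟨q, hq, x, hx, y, hy, hqx, hqy, hxy, hxy'⟩ := h.exists_path
  obtain ⟨s, hs, hqs, hw⟩ := h.exists_not_covers q
  have hqs' : q ≠ s := fun e => hqs (Or.inl e)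
  have hxs : x ≠ s := fun e => hqs (Or.inr (e ▸ hqx))
  have hys : y ≠ s := fun e => hqs (Or.inr (e ▸ hqy))
  have hc : ({q, x, s, y} : Finset V).card = 4 := by simp [*, hqx.ne, hqy.ne, hys.symm]
  have hT : ∀ z, ¬ Covers G v z → z = q ∨ z = x ∨ z = s ∨ z = y := by
    have hle := Finset.card_le_card h.subset_uncovered
    have h2 := card_uncovered_add_degree (G := G) v
    have e := Finset.eq_of_subset_of_card_le (s := {q, x, s, y}) (t := T)
      (by intro u; simp; rintro (rfl | rfl | rfl | rfl) <;> assumption) (by omega)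
    intro z hz
    have := h.mem_of_card_le hV (by have := h.four_le_card; omega) hz
    simpa [← e] using this
  have hsx : G.Adj s x := by
    by_contra hsx
    refine hw (h.win_of_unique_adj hs (Or.inr hqy) ?_ ?_)
    · obtain ⟨w, hwT, hsw⟩ := h.exists_adj hs
      rcases hT w (h.avoid w hwT) with rfl | rfl | rfl | rfl
      · exact absurd (Or.inr hsw.symm) hqs
      · exact absurd hsw hsx
      · exact absurd hsw (G.irrefl)
      · exact hsw.symm
    · intro w hwT hsw
      rcases hT w (h.avoid w hwT) with rfl | rfl | rfl | rfl
      · exact absurd (Or.inr hsw.symm) hqs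
      · exact absurd hsw hsx
      · exact absurd hsw (G.irrefl)
      · rfl
  have hsy : G.Adj s y := by
    by_contra hsy
    refine hw (h.win_of_unique_adj hs (Or.inr hqx) hsx.symm ?_)
    intro w hwT hsw
    rcases hT w (h.avoid w hwT) with rfl | rfl | rfl | rfl
    · exact absurd (Or.inr hsw.symm) hqs
    · rfl
    · exact absurd hsw (G.irrefl)
    · exact absurd hsw hsy
  have hesc : ∀ a b, (∀ z, ¬ Covers G v z → ¬ Covers G a z → z = b) → ¬ Win G v a b := by
    intro a b hab
    obtain ⟨r, hr, hc, hw⟩ := h.exists_not_covers a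
    exact hab r (h.avoid r hr) hc ▸ hw
  refine ⟨q, x, s, y, ⟨h.avoid q hq, h.avoid x hx, h.avoid s hs, h.avoid y hy, hqx, hsx.symm,
    hsy, hqy.symm, hqs, ?_, hT, ?_, ?_, ?_, ?_⟩⟩
  · rintro (e | e)
    exacts [hxy e, hxy' e]
  all_goals
    refine hesc _ _ fun z hz hc => ?_
    unfold Covers at hc
    rcases hT z hz with rfl | rfl | rfl | rfl <;>
      simp_all [G.adj_comm]

namespace Quad

variable {v p₀ p₁ p₂ p₃ : V}

lemma rotate (h : Quad G v p₀ p₁ p₂ p₃) : Quad G v p₁ p₂ p₃ p₀ where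
  avoid₀ := h.avoid₁
  avoid₁ := h.avoid₂
  avoid₂ := h.avoid₃
  avoid₃ := h.avoid₀
  adj₀₁ := h.adj₁₂
  adj₁₂ := h.adj₂₃
  adj₂₃ := h.adj₃₀
  adj₃₀ := h.adj₀₁
  not_covers₀₂ := h.not_covers₁₃
  not_covers₁₃ := fun e => h.not_covers₀₂ e.symm
  eq_or x hx := by have := h.eq_or x hx; tauto
  escape₀ := h.escape₁
  escape₁ := h.escape₂
  escape₂ := h.escape₃
  escape₃ := h.escape₀

lemma reflect (h : Quad G v p₀ p₁ p₂ p₃) : Quad G v p₀ p₃ p₂ p₁ where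
  avoid₀ := h.avoid₀
  avoid₁ := h.avoid₃
  avoid₂ := h.avoid₂
  avoid₃ := h.avoid₁
  adj₀₁ := h.adj₃₀.symm
  adj₁₂ := h.adj₂₃.symm
  adj₂₃ := h.adj₁₂.symm
  adj₃₀ := h.adj₀₁.symm
  not_covers₀₂ := h.not_covers₀₂
  not_covers₁₃ := fun e => h.not_covers₁₃ e.symm
  eq_or x hx := by have := h.eq_or x hx; tauto
  escape₀ := h.escape₀
  escape₁ := h.escape₃
  escape₂ := h.escape₂
  escape₃ := h.escape₁

/-- No vertex of the four-cycle misses two of the others. -/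
lemma eq_of_not_covers (h : Quad G v p₀ p₁ p₂ p₃) {x y z : V} (hx : ¬ Covers G v x)
    (hy : ¬ Covers G v y) (hz : ¬ Covers G v z) (hxy : ¬ Covers G x y) (hxz : ¬ Covers G x z) :
    y = z := by
  have h01 := h.adj₀₁
  have h12 := h.adj₁₂
  have h23 := h.adj₂₃
  have h30 := h.adj₃₀
  unfold Covers at hxy hxz
  have ex := h.eq_or x hx
  have ey := h.eq_or y hy
  have ez := h.eq_or z hz
  clear h hx hy hz
  rcases ex with rfl | rfl | rfl | rfl <;> rcases ey with rfl | rfl | rfl | rfl <;>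
    rcases ez with rfl | rfl | rfl | rfl <;> simp_all [G.adj_comm]

/-- A robber's corner has two non-adjacent neighbours adjacent to `v`. -/
lemma exists_pair (h : Quad G v p₀ p₁ p₂ p₃) (hG : G.Connected) :
    ∃ a b, G.Adj v a ∧ G.Adj v b ∧ G.Adj p₂ a ∧ G.Adj p₂ b ∧ ¬ Covers G p₀ a ∧
      ¬ Covers G p₀ b ∧ ¬ Covers G a b := by
  have key : ∀ y, G.Adj p₂ y → ¬ Covers G p₀ y → G.Adj v y := by
    intro y hy hc
    by_contra hvy
    have hv : ¬ Covers G v y := by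
      rintro (rfl | e)
      · exact h.avoid₂ (Or.inr hy.symm)
      · exact hvy e
    rcases h.eq_or y hv with rfl | rfl | rfl | rfl
    · exact hc (.refl _)
    · exact hc (Or.inr h.adj₀₁)
    · exact G.irrefl hy
    · exact hc (Or.inr h.adj₃₀.symm)
  obtain ⟨a, ha, hca⟩ : ∃ a, G.Adj p₂ a ∧ ¬ Covers G p₀ a := by
    by_contra! hn
    exact h.escape₂ (.of_trapped hG v hn)
  have hva := key a ha hca
  obtain ⟨b, hb, hab, hcb⟩ : ∃ b, Covers G p₂ b ∧ ¬ Covers G a b ∧ ¬ Covers G p₀ b := by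
    by_contra! hn
    exact h.escape₂ (.of_surround_left a (Or.inr hva) fun y hy =>
      or_iff_not_imp_left.2 fun hy' => hn y hy hy')
  rcases hb with rfl | hb
  · exact absurd (Or.inr ha.symm) hab
  · exact ⟨a, b, hva, key b hb hcb, ha, hb, hca, hcb, hab⟩

lemma exists_extra_adj (h : Quad G v p₀ p₁ p₂ p₃) {a b : V} (hva : G.Adj v a) (hvb : G.Adj v b)
    (ha : G.Adj p₂ a) (h1b : G.Adj p₁ b) (hN : ∀ y, G.Adj p₂ y → y = p₁ ∨ y = p₃ ∨ y = a ∨ y = b) :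
    ∃ z, G.Adj b z ∧ z ≠ v ∧ z ≠ p₁ ∧ z ≠ p₂ := by
  by_contra! hn
  refine h.escape₂ (.step_left a (Or.inr hva) fun y hy => ?_)
  rcases hy with rfl | hy
  · exact .of_covers_left (Or.inr ha.symm)
  rcases hN y hy with rfl | rfl | rfl | rfl
  · exact .of_covers_right (Or.inr h.adj₀₁)
  · exact .of_covers_right (Or.inr h.adj₃₀.symm)
  · exact .of_covers_left (.refl _)
  · refine .of_surround_right p₁ (Or.inr h.adj₀₁) fun z hz => ?_
    rcases hz with rfl | hz
    · exact Or.inr (Or.inr h1b)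
    · by_cases h1 : z = v
      · exact Or.inl (Or.inr (h1 ▸ hva.symm))
      · by_cases h2 : z = p₁
        · exact Or.inr (Or.inl h2.symm)
        · exact Or.inl (Or.inr (hn z hz h1 h2 ▸ ha.symm))

variable [Fintype V] [DecidableRel G.Adj]

/-- Consecutive corners do not share their neighbours adjacent to `v`. -/
lemma false_of_shared_pair (h : Quad G v p₀ p₁ p₂ p₃) (hΔ : ∀ x, G.degree x ≤ 4)
    (hQ : ∀ x, G.degree x = 4 → ∃ q₀ q₁ q₂ q₃, Quad G x q₀ q₁ q₂ q₃) {a b : V}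
    (hva : G.Adj v a) (hvb : G.Adj v b) (h1b : G.Adj p₁ b)
    (h2a : G.Adj p₂ a) (h2b : G.Adj p₂ b) (h0a : ¬ Covers G p₀ a) (h0b : ¬ Covers G p₀ b)
    (h3a : ¬ Covers G p₃ a) (h3b : ¬ Covers G p₃ b) (hab : ¬ Covers G a b) : False := by
  have hp : ∀ {p x}, ¬ Covers G v p → G.Adj v x → p ≠ x := fun hp hx e => hp (Or.inr (e ▸ hx))
  obtain ⟨z, hbz, hzv, hz1, hz2⟩ := h.exists_extra_adj hva hvb h2a h1b fun y hy =>
    eq_or_of_adj_four (hΔ p₂) h.adj₁₂.symm h.adj₂₃ h2a h2b (fun e => h.not_covers₁₃ (Or.inl e))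
      (hp h.avoid₁ hva) (hp h.avoid₁ hvb) (hp h.avoid₃ hva) (hp h.avoid₃ hvb)
      (fun e => hab (Or.inl e)) hy
  obtain ⟨q₀, q₁, q₂, q₃, hq⟩ := hQ b ((hΔ b).antisymm (four_le_degree hvb.symm h1b.symm h2b.symm
    hbz (fun e => h.avoid₁ (Or.inl e)) (fun e => h.avoid₂ (Or.inl e)) hzv.symm h.adj₁₂.ne
    hz1.symm hz2.symm))
  exact h.adj₃₀.ne (hq.eq_of_not_covers (fun e => hab e.symm) (fun e => h3b e.symm)
    (fun e => h0b e.symm) (fun e => h3a e.symm) (fun e => h0a e.symm))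

lemma degree_rooksGraph_three (x : Fin 3 × Fin 3) :
    (Finset.univ.filter fun y : Fin 3 × Fin 3 =>
      (x.1 ≠ y.1 ∧ x.2 = y.2) ∨ (x.2 ≠ y.2 ∧ x.1 = y.1)).card = 4 := by
  revert x
  decide

/-- A surjective homomorphism from the rooks graph to a graph on nine vertices of maximum degree
at most four is an isomorphism. -/
lemma nonempty_iso_rooksGraph (hV : Fintype.card V = 9) (hΔ : ∀ x, G.degree x ≤ 4)
    (f : Fin 3 → Fin 3 → V) (hf : ∀ x, ∃ i j, f i j = x)
    (hrow : ∀ i j k, j ≠ k → G.Adj (f i j) (f i k))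
    (hcol : ∀ i j k, i ≠ k → G.Adj (f i j) (f k j)) : Nonempty (G ≃g rooksGraph 3) := by
  classical
  let F : Fin 3 × Fin 3 → V := fun x => f x.1 x.2
  have hbij : Function.Bijective F := by
    rw [Fintype.bijective_iff_surjective_and_card]
    refine ⟨fun x => ?_, by simp [hV]⟩
    obtain ⟨i, j, h⟩ := hf x
    exact ⟨(i, j), h⟩
  have hadj : ∀ x y, (rooksGraph 3).Adj x y → G.Adj (F x) (F y) := by
    rintro ⟨i, j⟩ ⟨k, l⟩ h
    rcases h with ⟨h, rfl⟩ | ⟨h, rfl⟩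
    · exact hcol _ _ _ h
    · exact hrow _ _ _ h
  refine ⟨(SimpleGraph.Iso.symm ⟨Equiv.ofBijective F hbij, fun {x y} => ⟨fun h => ?_, hadj x y⟩⟩)⟩
  have hsub : (Finset.univ.filter fun y => (rooksGraph 3).Adj x y).image F ⊆
      G.neighborFinset (F x) := by
    intro z hz
    obtain ⟨y, hy, rfl⟩ := Finset.mem_image.1 hz
    simpa using hadj x y (Finset.mem_filter.1 hy).2
  have hcard : ((Finset.univ.filter fun y => (rooksGraph 3).Adj x y).image F).card = 4 := by
    rw [Finset.card_image_of_injective _ hbij.1, ← degree_rooksGraph_three x]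
    congr 1
    ext y
    simp [rooksGraph, SimpleGraph.boxProd_adj]
  have e := Finset.eq_of_subset_of_card_le hsub
    (by rw [hcard, SimpleGraph.card_neighborFinset_eq_degree]; exact hΔ _)
  have hmem : F y ∈ G.neighborFinset (F x) := by simpa using h
  rw [← e, Finset.mem_image] at hmem
  obtain ⟨y', hy', he⟩ := hmem
  exact hbij.1 he ▸ (Finset.mem_filter.1 hy').2

lemma nonempty_iso (h : Quad G v p₀ p₁ p₂ p₃) (hV : Fintype.card V = 9)
    (hΔ : ∀ x, G.degree x ≤ 4) {a b c d : V}
    (hva : G.Adj v a) (hvb : G.Adj v b) (hvc : G.Adj v c) (hvd : G.Adj v d)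
    (h2a : G.Adj p₂ a) (h2b : G.Adj p₂ b) (h0c : G.Adj p₀ c) (h0d : G.Adj p₀ d)
    (h1a : G.Adj p₁ a) (h1c : G.Adj p₁ c) (h3b : G.Adj p₃ b) (h3d : G.Adj p₃ d)
    (h0a : ¬ Covers G p₀ a) (h0b : ¬ Covers G p₀ b)
    (h2c : ¬ Covers G p₂ c) (h2d : ¬ Covers G p₂ d)
    (h3a : ¬ Covers G p₃ a) (h1b : ¬ Covers G p₁ b)
    (hab : ¬ Covers G a b) (hac : ¬ Covers G a c) (hbd : ¬ Covers G b d)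
    (hcd : ¬ Covers G c d) : Nonempty (G ≃g rooksGraph 3) := by
  have hp : ∀ {p x}, ¬ Covers G v p → G.Adj v x → p ≠ x := fun hp hx e => hp (Or.inr (e ▸ hx))
  have had' : a ≠ d := fun e => h2d (Or.inr (e ▸ h2a))
  have hbc' : b ≠ c := fun e => h2c (Or.inr (e ▸ h2b))
  have hNv : ∀ x, G.Adj v x → x = a ∨ x = b ∨ x = c ∨ x = d := fun x =>
    eq_or_of_adj_four (hΔ v) hva hvb hvc hvd (fun e => hab (Or.inl e))
      (fun e => hac (Or.inl e)) had' hbc' (fun e => hbd (Or.inl e)) (fun e => hcd (Or.inl e))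
  have hx : ∀ x, x = v ∨ (x = a ∨ x = b ∨ x = c ∨ x = d) ∨
      (x = p₀ ∨ x = p₁ ∨ x = p₂ ∨ x = p₃) := by
    intro x
    by_cases hc : Covers G v x
    · exact hc.elim (fun e => Or.inl e.symm) fun e => Or.inr (Or.inl (hNv x e))
    · exact Or.inr (Or.inr (h.eq_or x hc))
  have hN₂ : ∀ y, G.Adj p₂ y → y = p₁ ∨ y = p₃ ∨ y = b ∨ y = a := fun y hy =>
    eq_or_of_adj_four (hΔ p₂) h.adj₁₂.symm h.adj₂₃ h2b h2a (fun e => h.not_covers₁₃ (Or.inl e))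
      (hp h.avoid₁ hvb) (hp h.avoid₁ hva) (hp h.avoid₃ hvb) (hp h.avoid₃ hva)
      (fun e => hab (Or.inl e.symm)) hy
  have had : G.Adj a d := by
    obtain ⟨z, haz, hzv, hz1, hz2⟩ := h.exists_extra_adj hvb hva h2b h1a hN₂
    rcases hx z with e | (e | e | e | e) | (e | e | e | e) <;> subst e
    · exact absurd rfl hzv
    · exact absurd haz G.irrefl
    · exact absurd (Or.inr haz) hab
    · exact absurd (Or.inr haz) hac
    · exact haz
    · exact absurd (Or.inr haz.symm) h0a
    · exact absurd rfl hz1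
    · exact absurd rfl hz2
    · exact absurd (Or.inr haz.symm) h3a
  have hbc : G.Adj b c := by
    obtain ⟨z, haz, hzv, hz1, hz2⟩ := h.reflect.exists_extra_adj hva hvb h2a h3b
      (fun y hy => by have := hN₂ y hy; tauto)
    rcases hx z with e | (e | e | e | e) | (e | e | e | e) <;> subst e
    · exact absurd rfl hzv
    · exact absurd (Or.inr haz.symm) hab
    · exact absurd haz G.irrefl
    · exact haz
    · exact absurd (Or.inr haz) hbd
    · exact absurd (Or.inr haz.symm) h0b
    · exact absurd (Or.inr haz.symm) h1b
    · exact absurd rfl hz2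
    · exact absurd rfl hz1
  have h01 := h.adj₀₁
  have h12 := h.adj₁₂
  have h23 := h.adj₂₃
  have h30 := h.adj₃₀
  refine nonempty_iso_rooksGraph hV hΔ ![![v, a, d], ![b, p₂, p₃], ![c, p₁, p₀]] ?_ ?_ ?_
  · intro x
    rcases hx x with rfl | (rfl | rfl | rfl | rfl) | (rfl | rfl | rfl | rfl)
    exacts [⟨0, 0, rfl⟩, ⟨0, 1, rfl⟩, ⟨1, 0, rfl⟩, ⟨2, 0, rfl⟩, ⟨0, 2, rfl⟩, ⟨2, 2, rfl⟩,
      ⟨2, 1, rfl⟩, ⟨1, 1, rfl⟩, ⟨1, 2, rfl⟩]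
  · intro i j k hjk
    fin_cases i <;> fin_cases j <;> fin_cases k <;>
      first
      | exact absurd rfl hjk
      | (simp; assumption)
      | (simp; apply SimpleGraph.Adj.symm; assumption)
  · intro i j k hik
    fin_cases i <;> fin_cases j <;> fin_cases k <;>
      first
      | exact absurd rfl hik
      | (simp; assumption)
      | (simp; apply SimpleGraph.Adj.symm; assumption)

lemma nonempty_iso_of_forall (h : Quad G v p₀ p₁ p₂ p₃) (hG : G.Connected)
    (hV : Fintype.card V = 9) (hΔ : ∀ x, G.degree x ≤ 4)
    (hQ : ∀ x, G.degree x = 4 → ∃ q₀ q₁ q₂ q₃, Quad G x q₀ q₁ q₂ q₃) :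
    Nonempty (G ≃g rooksGraph 3) := by
  obtain ⟨a, b, hva, hvb, h2a, h2b, h0a, h0b, hab⟩ := h.exists_pair hG
  obtain ⟨c, d, hvc, hvd, h0c, h0d, h2c, h2d, hcd⟩ := h.rotate.rotate.exists_pair hG
  obtain ⟨e, f, hve, hvf, h1e, h1f, h3e, h3f, hef⟩ := h.rotate.rotate.rotate.exists_pair hG
  obtain ⟨g, k, hvg, hvk, h3g, h3k, h1g, h1k, hgk⟩ := h.rotate.exists_pair hG
  have ne : ∀ {x y}, G.Adj p₂ x → ¬ Covers G p₂ y → x ≠ y := fun hx hy e => hy (Or.inr (e ▸ hx))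
  have hNv : ∀ x, G.Adj v x → x = a ∨ x = b ∨ x = c ∨ x = d := fun x =>
    eq_or_of_adj_four (hΔ v) hva hvb hvc hvd (fun e => hab (Or.inl e)) (ne h2a h2c) (ne h2a h2d)
      (ne h2b h2c) (ne h2b h2d) (fun e => hcd (Or.inl e))
  have hba : ¬ Covers G b a := fun e => hab e.symm
  have hdc : ¬ Covers G d c := fun e => hcd e.symm
  have hfe : ¬ Covers G f e := fun e => hef e.symm
  have hkg : ¬ Covers G k g := fun e => hgk e.symm
  have key : ∀ {a b c d}, G.Adj v a → G.Adj v b → G.Adj v c → G.Adj v d → G.Adj p₂ a →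
      G.Adj p₂ b → G.Adj p₀ c → G.Adj p₀ d → ¬ Covers G p₀ a → ¬ Covers G p₀ b →
      ¬ Covers G p₂ c → ¬ Covers G p₂ d → ¬ Covers G a b → ¬ Covers G c d →
      G.Adj p₁ a → G.Adj p₁ c → ¬ Covers G p₃ a → ¬ Covers G p₃ c → ¬ Covers G a c →
      (∀ x, G.Adj v x → x = a ∨ x = b ∨ x = c ∨ x = d) → Nonempty (G ≃g rooksGraph 3) := by
    intro a b c d hva hvb hvc hvd h2a h2b h0c h0d h0a h0b h2c h2d hab hcd h1a h1c h3a h3c hac hN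
    have hbd : ∀ x, G.Adj p₃ x → ¬ Covers G p₁ x → G.Adj v x → x = b ∨ x = d := by
      intro x h3x h1x hvx
      rcases hN x hvx with rfl | rfl | rfl | rfl
      · exact absurd (Or.inr h1a) h1x
      · exact Or.inl rfl
      · exact absurd (Or.inr h1c) h1x
      · exact Or.inr rfl
    have hfin : G.Adj p₃ b → G.Adj p₃ d → ¬ Covers G p₁ b → ¬ Covers G b d →
        Nonempty (G ≃g rooksGraph 3) := fun h3b h3d h1b hbd =>
      h.nonempty_iso hV hΔ hva hvb hvc hvd h2a h2b h0c h0d h1a h1c h3b h3d h0a h0b h2c h2d h3a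
        h1b hab hac hbd hcd
    rcases hbd g h3g h1g hvg with rfl | rfl <;> rcases hbd k h3k h1k hvk with rfl | rfl
    · exact absurd (.refl _) hgk
    · exact hfin h3g h3k h1g hgk
    · exact hfin h3k h3g h1k hkg
    · exact absurd (.refl _) hgk
  rcases hNv e hve with rfl | rfl | rfl | rfl <;> rcases hNv f hvf with rfl | rfl | rfl | rfl
  all_goals first
    | exact absurd (.refl _) hef
    | exact (h.false_of_shared_pair hΔ hQ hva hvb h1f h2a h2b h0a h0b h3e h3f hab).elim
    | exact (h.false_of_shared_pair hΔ hQ hva hvb h1e h2a h2b h0a h0b h3f h3e hab).elim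
    | exact (h.rotate.rotate.rotate.false_of_shared_pair hΔ hQ hvc hvd h0d h1e h1f
        h3e h3f h2c h2d hcd).elim
    | exact (h.rotate.rotate.rotate.false_of_shared_pair hΔ hQ hvc hvd h0d h1f h1e
        h3f h3e h2c h2d hcd).elim
    | exact key hva hvb hvc hvd h2a h2b h0c h0d h0a h0b h2c h2d hab hcd (by assumption)
        (by assumption) (by assumption) (by assumption) (by assumption)
        (fun x hx => by have := hNv x hx; tauto)
    | exact key hva hvb hvd hvc h2a h2b h0d h0c h0a h0b h2d h2c hab hdc (by assumption)
        (by assumption) (by assumption) (by assumption) (by assumption)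
        (fun x hx => by have := hNv x hx; tauto)
    | exact key hvb hva hvc hvd h2b h2a h0c h0d h0b h0a h2c h2d hba hcd (by assumption)
        (by assumption) (by assumption) (by assumption) (by assumption)
        (fun x hx => by have := hNv x hx; tauto)
    | exact key hvb hva hvd hvc h2b h2a h0d h0c h0b h0a h2d h2c hba hdc (by assumption)
        (by assumption) (by assumption) (by assumption) (by assumption)
        (fun x hx => by have := hNv x hx; tauto)

end Quad

namespace IsLair

variable {v : V} {T : Finset V}

/-- In a subcubic graph every vertex of a lair misses two others. -/
lemma exists_two_not_covers [Fintype V] [DecidableRel G.Adj] (h : IsLair G v T)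
    (hG : G.Connected) (hΔ : ∀ x, G.degree x ≤ 3) (u : V) :
    ∃ s ∈ T, ∃ s' ∈ T, s ≠ s' ∧ ¬ Covers G u s ∧ ¬ Covers G u s' := by
  obtain ⟨s, hs, hus, hw⟩ := h.exists_not_covers u
  by_contra! hn
  have hcov : ∀ t ∈ T, t ≠ s → Covers G u t := by
    intro t ht hts
    by_contra hc
    exact hc (hn s hs t ht hts.symm hus)
  obtain ⟨w, hwT, hsw⟩ := h.exists_adj hs
  have huw := hcov w hwT hsw.ne'
  obtain ⟨w', hwT', hsw', hww⟩ : ∃ w' ∈ T, G.Adj s w' ∧ w' ≠ w := by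
    by_contra! hu
    exact hw (h.win_of_unique_adj hs huw hsw.symm hu)
  have huw' := hcov w' hwT' hsw'.ne'
  obtain ⟨e, hse, hue⟩ : ∃ e, G.Adj s e ∧ ¬ Covers G u e := by
    by_contra! hu
    exact hw (.of_trapped hG v hu)
  have hve : Covers G v e := by
    by_contra hc
    exact hue (hcov e (h.closed s hs e hse hc) hse.ne')
  refine hw (.of_surround_left e hve fun y hy => ?_)
  rcases hy with rfl | hy
  · exact Or.inl (Or.inr hse.symm)
  · rcases eq_or_of_adj_three (hΔ s) hsw hsw' hse hww.symm (fun e => hue (e ▸ huw))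
      (fun e => hue (e ▸ huw')) hy with rfl | rfl | rfl
    exacts [Or.inr huw, Or.inr huw', Or.inl (.refl _)]

/-- In a graph of maximum degree two there are no lairs. -/
lemma exists_three_le_degree [Fintype V] [DecidableRel G.Adj] (h : IsLair G v T)
    (hG : G.Connected) : ∃ x, 3 ≤ G.degree x := by
  by_contra! hd
  have hdeg : ∀ q ∈ T, ∀ x ∈ T, ∀ y ∈ T, ∀ z ∈ T, G.Adj q x → G.Adj q y → G.Adj q z →
      x = y ∨ x = z ∨ y = z := by
    intro q _ x _ y _ z _ hx hy hz
    by_contra! hn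
    exact (hd q).not_ge (three_le_degree hx hy hz hn.1 hn.2.1 hn.2.2)
  obtain ⟨p, hp, e, he, hpe⟩ := exists_boundary hG h.nonempty
    (fun hv => h.avoid v hv (.refl v))
  obtain ⟨q, hq, hpq⟩ := h.exists_adj hp
  obtain ⟨x, hx, hpx, hxq⟩ := h.exists_ne_adj hdeg hp hq hpq
  exact (hd p).not_ge (three_le_degree hpe hpq hpx (fun e' => he (e' ▸ hq))
    (fun e' => he (e' ▸ hx)) hxq.symm)

end IsLair

/-- The vertices not covered by `v` form an induced five-cycle. -/
structure Pent (G : SimpleGraph V) (v p₀ p₁ p₂ p₃ p₄ : V) : Prop where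
  avoid₀ : ¬ Covers G v p₀
  avoid₁ : ¬ Covers G v p₁
  avoid₂ : ¬ Covers G v p₂
  avoid₃ : ¬ Covers G v p₃
  avoid₄ : ¬ Covers G v p₄
  adj₀₁ : G.Adj p₀ p₁
  adj₁₂ : G.Adj p₁ p₂
  adj₂₃ : G.Adj p₂ p₃
  adj₃₄ : G.Adj p₃ p₄
  adj₄₀ : G.Adj p₄ p₀
  not_covers₀₂ : ¬ Covers G p₀ p₂
  not_covers₁₃ : ¬ Covers G p₁ p₃
  not_covers₂₄ : ¬ Covers G p₂ p₄
  not_covers₃₀ : ¬ Covers G p₃ p₀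
  not_covers₄₁ : ¬ Covers G p₄ p₁
  eq_or : ∀ x, ¬ Covers G v x → x = p₀ ∨ x = p₁ ∨ x = p₂ ∨ x = p₃ ∨ x = p₄

lemma IsLair.exists_pent [Fintype V] [DecidableRel G.Adj] {v : V} {T : Finset V}
    (h : IsLair G v T) (hG : G.Connected) (hV : Fintype.card V = 9)
    (hΔ : ∀ x, G.degree x ≤ 3) (hv : G.degree v = 3) :
    ∃ p₀ p₁ p₂ p₃ p₄, Pent G v p₀ p₁ p₂ p₃ p₄ := by
  classical
  obtain ⟨q, hq, x, hx, y, hy, hqx, hqy, hxy, hxy'⟩ := h.exists_path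
  have hcard := Finset.card_le_card h.subset_uncovered
  have hunc := card_uncovered_add_degree (G := G) v
  have hdeg : ∀ q ∈ T, ∀ x ∈ T, ∀ y ∈ T, ∀ z ∈ T, G.Adj q x → G.Adj q y → G.Adj q z →
      x = y ∨ x = z ∨ y = z := by
    intro u hu x hx y hy z hz hux huy huz
    by_contra! hn
    obtain ⟨s, hs, s', hs', hss, hus, hus'⟩ := h.exists_two_not_covers hG hΔ u
    have ne : ∀ {t s}, G.Adj u t → ¬ Covers G u s → t ≠ s := fun ht hs e =>
      hs (Or.inr (e ▸ ht))
    have ne' : ∀ {s}, ¬ Covers G u s → u ≠ s := fun hs e => hs (Or.inl e)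
    have hc : ({u, x, y, z, s, s'} : Finset V).card = 6 := by
      simp [hux.ne, huy.ne, huz.ne, hn.1, hn.2.1, hn.2.2, ne hux hus, ne hux hus', ne huy hus,
        ne huy hus', ne huz hus, ne huz hus', ne' hus, ne' hus', hss]
    have := Finset.card_le_card (s := {u, x, y, z, s, s'}) (t := T)
      (by intro w; simp; rintro (rfl | rfl | rfl | rfl | rfl | rfl) <;> assumption)
    omega
  obtain ⟨s, hs, s', hs', hss, hqs, hqs'⟩ := h.exists_two_not_covers hG hΔ q
  have ne : ∀ {t s}, G.Adj q t → ¬ Covers G q s → t ≠ s := fun ht hs e => hs (Or.inr (e ▸ ht))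
  have ne' : ∀ {s}, ¬ Covers G q s → q ≠ s := fun hs e => hs (Or.inl e)
  have hT : ∀ z, ¬ Covers G v z → z = q ∨ z = x ∨ z = y ∨ z = s ∨ z = s' := by
    have hc : ({q, x, y, s, s'} : Finset V).card = 5 := by
      simp [hqx.ne, hqy.ne, hxy, ne hqx hqs, ne hqx hqs', ne hqy hqs, ne hqy hqs', ne' hqs,
        ne' hqs', hss]
    have hsub : ({q, x, y, s, s'} : Finset V) ⊆ T := by
      intro w; simp; rintro (rfl | rfl | rfl | rfl | rfl) <;> assumption
    have hle := Finset.card_le_card hsub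
    have e := Finset.eq_of_subset_of_card_le hsub (by omega)
    intro z hz
    have := h.mem_of_card_le hV (by omega) hz
    simpa [← e] using this
  have main : ∀ s s', s ∈ T → s' ∈ T → ¬ Covers G q s → ¬ Covers G q s' → s ≠ s' →
      (∀ z, ¬ Covers G v z → z = q ∨ z = x ∨ z = y ∨ z = s ∨ z = s') → G.Adj x s →
      ∃ p₀ p₁ p₂ p₃ p₄, Pent G v p₀ p₁ p₂ p₃ p₄ := by
    intro s s' hs hs' hqs hqs' hss hT hxs
    have ncov : ∀ {a b}, a ≠ b → ¬ G.Adj a b → ¬ Covers G a b := fun h1 h2 h3 => h3.elim h1 h2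
    have hsq : ¬ G.Adj s q := fun e => hqs (Or.inr e.symm)
    have hsq' : ¬ G.Adj s' q := fun e => hqs' (Or.inr e.symm)
    have hxs' : ¬ G.Adj x s' := fun e => by
      rcases hdeg x hx q hq s hs s' hs' hqx.symm hxs e with e | e | e
      exacts [ne' hqs e, ne' hqs' e, hss e]
    have two : ∀ p ∈ T, ∃ a ∈ T, ∃ b ∈ T, G.Adj p a ∧ G.Adj p b ∧ a ≠ b := by
      intro p hp
      obtain ⟨a, ha, hpa⟩ := h.exists_adj hp
      obtain ⟨b, hb, hpb, hba⟩ := h.exists_ne_adj hdeg hp ha hpa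
      exact ⟨a, ha, b, hb, hpa, hpb, hba.symm⟩
    have hN' : ∀ z ∈ T, G.Adj s' z → z = y ∨ z = s := by
      intro z hz hsz
      rcases hT z (h.avoid z hz) with rfl | rfl | rfl | rfl | rfl
      · exact absurd hsz hsq'
      · exact absurd hsz.symm hxs'
      · exact Or.inl rfl
      · exact Or.inr rfl
      · exact absurd hsz G.irrefl
    have hs'N : G.Adj s' y ∧ G.Adj s' s := by
      obtain ⟨a, ha, b, hb, hsa, hsb, hab⟩ := two s' hs'
      rcases hN' a ha hsa with rfl | rfl <;> rcases hN' b hb hsb with rfl | rfl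
      · exact absurd rfl hab
      · exact ⟨hsa, hsb⟩
      · exact ⟨hsb, hsa⟩
      · exact absurd rfl hab
    have hys : ¬ G.Adj y s := fun e => by
      rcases hdeg y hy q hq s hs s' hs' hqy.symm e hs'N.1.symm with e | e | e
      exacts [ne' hqs e, ne' hqs' e, hss e]
    exact ⟨q, x, s, s', y, h.avoid q hq, h.avoid x hx, h.avoid s hs, h.avoid s' hs',
      h.avoid y hy, hqx, hxs, hs'N.2.symm, hs'N.1, hqy.symm, hqs, ncov (ne hqx hqs') hxs',
      ncov (ne hqy hqs).symm (fun e => hys e.symm), fun e => hqs' e.symm,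
      ncov hxy.symm (fun e => hxy' e.symm), fun z hz => by have := hT z hz; tauto⟩
  obtain ⟨t, htT, hxt, htq⟩ := h.exists_ne_adj hdeg hx hq hqx.symm
  rcases hT t (h.avoid t htT) with rfl | rfl | rfl | rfl | rfl
  · exact absurd rfl htq
  · exact absurd hxt G.irrefl
  · exact absurd hxt hxy'
  · exact main _ _ hs hs' hqs hqs' hss hT hxt
  · exact main _ _ hs' hs hqs' hqs hss.symm (fun z hz => by have := hT z hz; tauto) hxt

namespace Pent

variable {v p₀ p₁ p₂ p₃ p₄ : V}

lemma rotate (h : Pent G v p₀ p₁ p₂ p₃ p₄) : Pent G v p₁ p₂ p₃ p₄ p₀ where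
  avoid₀ := h.avoid₁
  avoid₁ := h.avoid₂
  avoid₂ := h.avoid₃
  avoid₃ := h.avoid₄
  avoid₄ := h.avoid₀
  adj₀₁ := h.adj₁₂
  adj₁₂ := h.adj₂₃
  adj₂₃ := h.adj₃₄
  adj₃₄ := h.adj₄₀
  adj₄₀ := h.adj₀₁
  not_covers₀₂ := h.not_covers₁₃
  not_covers₁₃ := h.not_covers₂₄
  not_covers₂₄ := h.not_covers₃₀
  not_covers₃₀ := h.not_covers₄₁
  not_covers₄₁ := h.not_covers₀₂
  eq_or x hx := by have := h.eq_or x hx; tauto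

lemma exists_adj_adj (h : Pent G v p₀ p₁ p₂ p₃ p₄) {x : V} (hx : ¬ Covers G v x) :
    ∃ y z, y ≠ z ∧ ¬ Covers G v y ∧ ¬ Covers G v z ∧ G.Adj x y ∧ G.Adj x z := by
  have key : ∀ {p₀ p₁ p₂ p₃ p₄}, Pent G v p₀ p₁ p₂ p₃ p₄ →
      ∃ y z, y ≠ z ∧ ¬ Covers G v y ∧ ¬ Covers G v z ∧ G.Adj p₀ y ∧ G.Adj p₀ z :=
    fun h => ⟨_, _, fun e => h.not_covers₄₁ (Or.inl e.symm), h.avoid₁, h.avoid₄, h.adj₀₁,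
      h.adj₄₀.symm⟩
  rcases h.eq_or x hx with rfl | rfl | rfl | rfl | rfl
  exacts [key h, key h.rotate, key h.rotate.rotate, key h.rotate.rotate.rotate,
    key h.rotate.rotate.rotate.rotate]

lemma eq_or_of_adj (h : Pent G v p₀ p₁ p₂ p₃ p₄) {x y z t : V} (hx : ¬ Covers G v x)
    (hy : ¬ Covers G v y) (hz : ¬ Covers G v z) (ht : ¬ Covers G v t)
    (hxy : G.Adj x y) (hxz : G.Adj x z) (hxt : G.Adj x t) : y = z ∨ y = t ∨ z = t := by
  have key : ∀ {p₀ p₁ p₂ p₃ p₄}, Pent G v p₀ p₁ p₂ p₃ p₄ → ∀ y, ¬ Covers G v y →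
      G.Adj p₀ y → y = p₁ ∨ y = p₄ := by
    intro p₀ p₁ p₂ p₃ p₄ h y hy hxy
    rcases h.eq_or y hy with rfl | rfl | rfl | rfl | rfl
    · exact absurd hxy G.irrefl
    · exact Or.inl rfl
    · exact absurd (Or.inr hxy) h.not_covers₀₂
    · exact absurd (Or.inr hxy.symm) h.not_covers₃₀
    · exact Or.inr rfl
  have fin : ∀ {p₀ p₁ p₂ p₃ p₄}, Pent G v p₀ p₁ p₂ p₃ p₄ → x = p₀ → y = z ∨ y = t ∨ z = t := by
    rintro p₀ p₁ p₂ p₃ p₄ h rfl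
    have h1 := key h y hy hxy
    have h2 := key h z hz hxz
    have h3 := key h t ht hxt
    grind
  rcases h.eq_or x hx with e | e | e | e | e
  exacts [fin h e, fin h.rotate e, fin h.rotate.rotate e, fin h.rotate.rotate.rotate e,
    fin h.rotate.rotate.rotate.rotate e]

variable [Fintype V] [DecidableRel G.Adj]

lemma eq_or_of_adj_zero (h : Pent G v p₀ p₁ p₂ p₃ p₄) (hΔ : ∀ x, G.degree x ≤ 3) {a y : V}
    (hva : G.Adj v a) (ha : G.Adj p₀ a) (hy : G.Adj p₀ y) : y = p₁ ∨ y = p₄ ∨ y = a :=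
  eq_or_of_adj_three (hΔ p₀) h.adj₀₁ h.adj₄₀.symm ha
    (fun e => h.not_covers₄₁ (Or.inl e.symm)) (fun e => h.avoid₁ (Or.inr (e ▸ hva)))
    (fun e => h.avoid₄ (Or.inr (e ▸ hva))) hy

lemma unique_adj_zero (h : Pent G v p₀ p₁ p₂ p₃ p₄) (hΔ : ∀ x, G.degree x ≤ 3) {a y : V}
    (hva : G.Adj v a) (ha : G.Adj p₀ a) (hvy : G.Adj v y) (hy : G.Adj p₀ y) : y = a := by
  rcases h.eq_or_of_adj_zero hΔ hva ha hy with rfl | rfl | e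
  · exact absurd (Or.inr hvy) h.avoid₁
  · exact absurd (Or.inr hvy) h.avoid₄
  · exact e

lemma degree_zero (h : Pent G v p₀ p₁ p₂ p₃ p₄) (hΔ : ∀ x, G.degree x ≤ 3) {a : V}
    (hva : G.Adj v a) (ha : G.Adj p₀ a) : G.degree p₀ = 3 :=
  (hΔ p₀).antisymm (three_le_degree h.adj₀₁ h.adj₄₀.symm ha
    (fun e => h.not_covers₄₁ (Or.inl e.symm)) (fun e => h.avoid₁ (Or.inr (e ▸ hva)))
    (fun e => h.avoid₄ (Or.inr (e ▸ hva))))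

lemma exists_adj_two (h : Pent G v p₀ p₁ p₂ p₃ p₄) (hΔ : ∀ x, G.degree x ≤ 3)
    (hP : ∀ x, G.degree x = 3 → ∃ q₀ q₁ q₂ q₃ q₄, Pent G x q₀ q₁ q₂ q₃ q₄) {a : V}
    (hva : G.Adj v a) (ha : G.Adj p₀ a) : ∃ e, G.Adj v e ∧ G.Adj p₂ e ∧ e ≠ a := by
  obtain ⟨q₀, q₁, q₂, q₃, q₄, hq⟩ := hP p₀ (h.degree_zero hΔ hva ha)
  obtain ⟨y, z, hyz, hy, hz, h2y, h2z⟩ := hq.exists_adj_adj h.not_covers₀₂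
  have key : ∀ e, ¬ Covers G p₀ e → G.Adj p₂ e → e ≠ p₃ → ∃ e, G.Adj v e ∧ G.Adj p₂ e ∧ e ≠ a := by
    intro e he h2e he3
    refine ⟨e, ?_, h2e, fun e' => he (Or.inr (e' ▸ ha))⟩
    by_contra hve
    have hv : ¬ Covers G v e := by
      rintro (rfl | hc)
      · exact h.avoid₂ (Or.inr h2e.symm)
      · exact hve hc
    rcases h.eq_or e hv with rfl | rfl | rfl | rfl | rfl
    · exact he (.refl _)
    · exact he (Or.inr h.adj₀₁)
    · exact G.irrefl h2e
    · exact he3 rfl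
    · exact h.not_covers₂₄ (Or.inr h2e)
  by_cases hy3 : y = p₃
  · exact key z hz h2z fun e => hyz (hy3.trans e.symm)
  · exact key y hy h2y hy3

lemma false_of_common_adj (h : Pent G v p₀ p₁ p₂ p₃ p₄) (hΔ : ∀ x, G.degree x ≤ 3)
    (hP : ∀ x, G.degree x = 3 → ∃ q₀ q₁ q₂ q₃ q₄, Pent G x q₀ q₁ q₂ q₃ q₄) {a e : V}
    (hva : G.Adj v a) (h0 : G.Adj p₀ a) (h1 : G.Adj p₁ a) (hve : G.Adj v e)
    (h3 : G.Adj p₃ e) : False := by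
  obtain ⟨q₀, q₁, q₂, q₃, q₄, hq⟩ := hP p₃ (h.rotate.rotate.rotate.degree_zero hΔ hve h3)
  have h01 := h.adj₀₁.ne
  have hv0 : v ≠ p₀ := fun e => h.avoid₀ (Or.inl e)
  have hv1 : v ≠ p₁ := fun e => h.avoid₁ (Or.inl e)
  have hp3a : ¬ G.Adj p₃ a := by
    intro h3a
    rcases eq_or_of_adj_three (hΔ a) hva.symm h0.symm h1.symm hv0 hv1 h01 h3a.symm with
      e | e | e
    · exact h.avoid₃ (Or.inl e.symm)
    · exact h.not_covers₃₀ (Or.inl e)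
    · exact h.not_covers₁₃ (Or.inl e.symm)
  rcases hq.eq_or_of_adj (x := a) (y := v) (z := p₀) (t := p₁)
    (fun c => c.elim (fun e => h.avoid₃ (Or.inr (e ▸ hva))) hp3a) (fun c => h.avoid₃ c.symm)
    h.not_covers₃₀ (fun c => h.not_covers₁₃ c.symm) hva.symm h0.symm h1.symm with e | e | e
  exacts [hv0 e, hv1 e, h01 e]

lemma false_of_forall (h : Pent G v p₀ p₁ p₂ p₃ p₄) (hG : G.Connected)
    (hΔ : ∀ x, G.degree x ≤ 3)
    (hP : ∀ x, G.degree x = 3 → ∃ q₀ q₁ q₂ q₃ q₄, Pent G x q₀ q₁ q₂ q₃ q₄) : False := by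
  have main : ∀ {p₀ p₁ p₂ p₃ p₄ a}, Pent G v p₀ p₁ p₂ p₃ p₄ → G.Adj v a → G.Adj p₀ a →
      False := by
    intro p₀ p₁ p₂ p₃ p₄ a₀ h hva₀ h0
    have r1 := h.rotate
    have r2 := r1.rotate
    have r3 := r2.rotate
    have r4 := r3.rotate
    obtain ⟨a₂, hva₂, h2, h20⟩ := h.exists_adj_two hΔ hP hva₀ h0
    obtain ⟨a₄, hva₄, h4, h42⟩ := r2.exists_adj_two hΔ hP hva₂ h2
    obtain ⟨a₁, hva₁, h1, h14⟩ := r4.exists_adj_two hΔ hP hva₄ h4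
    obtain ⟨a₃, hva₃, h3, h31⟩ := r1.exists_adj_two hΔ hP hva₁ h1
    obtain ⟨a₀', hva₀', h0', h03⟩ := r3.exists_adj_two hΔ hP hva₃ h3
    rw [h.unique_adj_zero hΔ hva₀ h0 hva₀' h0'] at h03
    have h01 : a₀ ≠ a₁ := fun e =>
      h.false_of_common_adj hΔ hP hva₀ h0 (e ▸ h1) hva₃ h3
    have h12 : a₁ ≠ a₂ := fun e =>
      r1.false_of_common_adj hΔ hP hva₁ h1 (e ▸ h2) hva₄ h4
    have h23 : a₂ ≠ a₃ := fun e =>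
      r2.false_of_common_adj hΔ hP hva₂ h2 (e ▸ h3) hva₀ h0
    have := four_le_degree hva₀ hva₁ hva₂ hva₃ h01 h20.symm h03 h12 h31.symm h23
    have := hΔ v
    omega
  obtain ⟨p, hp, e, he, hpe⟩ := exists_boundary hG (T := uncovered G v) (v := v)
    ⟨p₀, mem_uncovered.2 h.avoid₀⟩ fun hv => mem_uncovered.1 hv (.refl v)
  rw [mem_uncovered] at hp he
  rw [not_not] at he
  have hve : G.Adj v e := he.resolve_left fun e' => hp (Or.inr (e' ▸ hpe.symm))
  rcases h.eq_or p hp with rfl | rfl | rfl | rfl | rfl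
  exacts [main h hve hpe, main h.rotate hve hpe, main h.rotate.rotate hve hpe,
    main h.rotate.rotate.rotate hve hpe, main h.rotate.rotate.rotate.rotate hve hpe]

end Pent

lemma lazyCopsWin_two [Fintype V] (hV : Fintype.card V = 9) (hG : G.Connected)
    (hiso : ¬ Nonempty (G ≃g rooksGraph 3)) : LazyCopsWin G 2 := by
  classical
  by_contra hw
  have hlair := exists_isLair hG hw
  have hΔ : ∀ x, G.degree x ≤ 4 := fun x => (hlair x).choose_spec.degree_le_four hV
  have hQ : ∀ x, G.degree x = 4 → ∃ q₀ q₁ q₂ q₃, Quad G x q₀ q₁ q₂ q₃ := fun x hx =>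
    (hlair x).choose_spec.exists_quad hV hx
  by_cases h4 : ∃ x, G.degree x = 4
  · obtain ⟨x, hx⟩ := h4
    obtain ⟨q₀, q₁, q₂, q₃, hq⟩ := hQ x hx
    exact hiso (hq.nonempty_iso_of_forall hG hV hΔ hQ)
  · push Not at h4
    have hΔ' : ∀ x, G.degree x ≤ 3 := fun x => by
      have := hΔ x
      have := h4 x
      omega
    have hP : ∀ x, G.degree x = 3 → ∃ q₀ q₁ q₂ q₃ q₄, Pent G x q₀ q₁ q₂ q₃ q₄ := fun x hx =>
      (hlair x).choose_spec.exists_pent hG hV hΔ' hx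
    obtain ⟨v⟩ := hG.nonempty
    obtain ⟨x, hx⟩ := (hlair v).choose_spec.exists_three_le_degree hG
    obtain ⟨q₀, q₁, q₂, q₃, q₄, hq⟩ := hP x ((hΔ' x).antisymm hx)
    exact hq.false_of_forall hG hΔ' hP

end Lazy

/-- Closed neighbourhoods in the three by three rooks graph, in decidable form. -/
def SameLine (x y : Fin 3 × Fin 3) : Prop := x.1 = y.1 ∨ x.2 = y.2

instance : DecidableRel SameLine := fun x y =>
  inferInstanceAs (Decidable (x.1 = y.1 ∨ x.2 = y.2))

lemma covers_rooksGraph {x y : Fin 3 × Fin 3} : Covers (rooksGraph 3) x y ↔ SameLine x y := by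
  simp only [Covers, SameLine, rooksGraph, SimpleGraph.boxProd_adj, SimpleGraph.top_adj,
    Prod.ext_iff]
  tauto

lemma exists_not_sameLine (a b : Fin 3 × Fin 3) : ∃ r, ¬ SameLine a r ∧ ¬ SameLine b r := by
  revert a b
  decide

lemma exists_escape (a b r : Fin 3 × Fin 3) (ha : r ≠ a) (hb : ¬ SameLine b r) :
    ∃ r', SameLine r r' ∧ ¬ SameLine a r' ∧ ¬ SameLine b r' := by
  revert a b r
  decide +kernel

/-- A robber standing off the lines of at most two cops evades them forever. -/
lemma not_lazyWinFrom_rooksGraph {k : ℕ} (hk : k ≤ 2) {c : Fin k → Fin 3 × Fin 3}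
    {r : Fin 3 × Fin 3} (h : LazyWinFrom (rooksGraph 3) c r) :
    ∃ i, SameLine (c i) r := by
  induction h with
  | caught i h => exact ⟨i, h ▸ Or.inl rfl⟩
  | @stepCatch c r c' j hmove hfix i h =>
    by_cases hij : i = j
    · subst hij
      exact ⟨i, covers_rooksGraph.1 (h ▸ hmove.imp Eq.symm id)⟩
    · exact ⟨i, Or.inl (by rw [← hfix i hij, h])⟩
  | @step c r c' j hmove hfix _ ih =>
    by_contra! hn
    have hcj : SameLine (c j) (c' j) := covers_rooksGraph.1 (hmove.imp Eq.symm id)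
    have hne : r ≠ c' j := fun e => hn j (e ▸ hcj)
    obtain ⟨b, hb, hbi⟩ : ∃ b, ¬ SameLine b r ∧ ∀ i, i ≠ j → c i = b := by
      by_cases hi : ∃ i, i ≠ j
      · obtain ⟨i, hi⟩ := hi
        refine ⟨c i, hn i, fun i' hi' => ?_⟩
        congr 1
        omega
      · push Not at hi
        exact ⟨c j, hn j, fun i h => absurd (hi i) h⟩
    obtain ⟨r', hrr, hcov, hbr⟩ := exists_escape (c' j) b r hne hb
    obtain ⟨i, hi⟩ := ih r' ((covers_rooksGraph.2 hrr).imp Eq.symm id)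
    by_cases hij : i = j
    · exact hcov (hij ▸ hi)
    · rw [hfix i hij, hbi i hij] at hi
      exact hbr hi

lemma three_le_of_lazyCopsWin {k : ℕ} (h : LazyCopsWin (rooksGraph 3) k) : 3 ≤ k := by
  by_contra! hk
  obtain ⟨c, hc⟩ := h
  have hab : ∃ a b, ∀ i, c i = a ∨ c i = b := by
    by_cases hi : ∃ i : Fin k, True
    · obtain ⟨i, _⟩ := hi
      by_cases hj : ∃ j, j ≠ i
      · obtain ⟨j, hj⟩ := hj
        refine ⟨c i, c j, fun l => ?_⟩
        have : l = i ∨ l = j := by omega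
        exact this.imp (congrArg c) (congrArg c)
      · push Not at hj
        exact ⟨c i, c i, fun l => Or.inl (congrArg c (hj l))⟩
    · exact ⟨0, 0, fun i => absurd ⟨i, trivial⟩ hi⟩
  obtain ⟨a, b, hab⟩ := hab
  obtain ⟨r, ha, hb⟩ := exists_not_sameLine a b
  obtain ⟨i, hi⟩ := not_lazyWinFrom_rooksGraph (by omega) (hc r)
  rcases hab i with e | e
  · exact ha (e ▸ hi)
  · exact hb (e ▸ hi)

lemma lazyCopsWin_rooksGraph_three : LazyCopsWin (rooksGraph 3) 3 := by
  refine ⟨fun i => (i, i), fun r => ?_⟩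
  have h : Covers (rooksGraph 3) (r.1, r.1) r := covers_rooksGraph.2 (Or.inl rfl)
  refine .stepCatch (Function.update (fun i => (i, i)) r.1 r) r.1 ?_ (fun i hi => ?_) r.1 ?_
  · simpa using h.imp Eq.symm id
  · simp [hi]
  · simp

/-- `K_3 □ K_3` is the unique graph (up to isomorphism) on 9
vertices with lazy cop number 3: every connected simple graph on 9 vertices
not isomorphic to it has `c_L ≤ 2`, while `c_L(K_3 □ K_3) = 3`. -/
theorem rooks3_unique_smallest_lazyCopNumber_three :
    (∀ (W : Type*) [Fintype W] (H : SimpleGraph W), Fintype.card W = 9 →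
        H.Connected → ¬ Nonempty (H ≃g rooksGraph 3) → lazyCopNumber H ≤ 2) ∧
      lazyCopNumber (rooksGraph 3) = 3 := by
  refine ⟨fun W _ H hW hH hiso => Nat.sInf_le (lazyCopsWin_two hW hH hiso), ?_⟩
  exact (Nat.sInf_le lazyCopsWin_rooksGraph_three).antisymm
    (le_csInf ⟨3, lazyCopsWin_rooksGraph_three⟩ fun _ => three_le_of_lazyCopsWin)

end CopsRobbers
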